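/- arXiv:1911.12940 — 2 statements merged into one kernel-verified Lean document; each statement's English description precedes it below -/
import Mathlib

section
/- A regular T2 space X is a γ-space if and only if ℱ(X), the space of nonempty finite subsets of X with the Vietoris topology, is a γ-space. -/
open TopologicalSpace Set

/-- The hyperspace `𝒦(X)` of nonempty compact subsets of `X`. -/
structure VHyper (X : Type*) [TopologicalSpace X] where
  carrier : Set X
  isCompact' : IsCompact carrier
  nonempty' : carrier.Nonempty

namespace VHyper

variable {X : Type*} [TopologicalSpace X]

/-- The basic Vietoris set `⟨P₁, …, P_r⟩` determined by a finite family of subsets of `X`: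
all nonempty compact sets contained in the union and meeting every member. -/
def vbox (Ps : Finset (Set X)) : Set (VHyper X) :=
  {A : VHyper X | A.carrier ⊆ ⋃₀ (Ps : Set (Set X)) ∧ ∀ P ∈ Ps, (A.carrier ∩ P).Nonempty}

/-- The Vietoris topology on `𝒦(X)`, generated by the sets `⟨U₁, …, U_k⟩`
with all `U_i` open. -/
instance : TopologicalSpace (VHyper X) :=
  TopologicalSpace.generateFrom
    {S : Set (VHyper X) | ∃ Ps : Finset (Set X), (∀ U ∈ Ps, IsOpen U) ∧ S = vbox Ps}

end VHyper

/-- `ℱ(X)`: the subspace of `𝒦(X)` consisting of the nonempty finite subsets of `X`. -/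
def VFin (X : Type*) [TopologicalSpace X] := {A : VHyper X // A.carrier.Finite}

instance (X : Type*) [TopologicalSpace X] : TopologicalSpace (VFin X) :=
  inferInstanceAs (TopologicalSpace {A : VHyper X // A.carrier.Finite})

/-- `ℱ₂(X)`: the subspace of `𝒦(X)` consisting of the nonempty subsets of `X` of
cardinality at most 2. -/
def VFin2 (X : Type*) [TopologicalSpace X] := {A : VHyper X // A.carrier.encard ≤ 2}

instance (X : Type*) [TopologicalSpace X] : TopologicalSpace (VFin2 X) :=
  inferInstanceAs (TopologicalSpace {A : VHyper X // A.carrier.encard ≤ 2})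

/-- The family `ℬ = {⟨P₁,…,P_r⟩ : P₁,…,P_r ∈ Pfam, r ∈ ℕ}` of basic Vietoris sets built from
members of `Pfam`. -/
def boxFamily {X : Type*} [TopologicalSpace X] (Pfam : Set (Set X)) : Set (Set (VHyper X)) :=
  {B | ∃ Ps : Finset (Set X), Ps.Nonempty ∧ ↑Ps ⊆ Pfam ∧ B = VHyper.vbox Ps}

section Defs

variable {Y : Type*} [TopologicalSpace Y]

/-- `Pfam` is a k-network: for every compact `C` and open `U ⊇ C` there is a finite
subfamily `Qfam ⊆ Pfam` with `C ⊆ ⋃Qfam ⊆ U`. -/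
def IsKNetwork (Pfam : Set (Set Y)) : Prop :=
  ∀ C : Set Y, IsCompact C → ∀ U : Set Y, IsOpen U → C ⊆ U →
    ∃ Qfam : Set (Set Y), Qfam ⊆ Pfam ∧ Qfam.Finite ∧ C ⊆ ⋃₀ Qfam ∧ ⋃₀ Qfam ⊆ U

/-- Every point lies in at most countably many members of `Pfam`. -/
def PointCountableFam (Pfam : Set (Set Y)) : Prop :=
  ∀ y : Y, {P ∈ Pfam | y ∈ P}.Countable

/-- Every compact set meets at most countably many members of `Pfam`. -/
def CompactCountableFam (Pfam : Set (Set Y)) : Prop :=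
  ∀ C : Set Y, IsCompact C → {P ∈ Pfam | (C ∩ P).Nonempty}.Countable

/-- Every point has a neighborhood meeting at most countably many members of `Pfam`. -/
def LocallyCountableFam (Pfam : Set (Set Y)) : Prop :=
  ∀ y : Y, ∃ O ∈ nhds y, {P ∈ Pfam | (O ∩ P).Nonempty}.Countable

/-- Every point has a neighborhood meeting only finitely many members of `Pfam`. -/
def LocallyFiniteFam (Pfam : Set (Set Y)) : Prop :=
  ∀ y : Y, ∃ O ∈ nhds y, {P ∈ Pfam | (O ∩ P).Nonempty}.Finite

/-- Every compact set meets only finitely many members of `Pfam`. -/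
def CompactFiniteFam (Pfam : Set (Set Y)) : Prop :=
  ∀ C : Set Y, IsCompact C → {P ∈ Pfam | (C ∩ P).Nonempty}.Finite

/-- `Pfam` is a base for the topology: all members are open, and every open set is a union of
members around each of its points. -/
def IsBaseFam (Pfam : Set (Set Y)) : Prop :=
  (∀ P ∈ Pfam, IsOpen P) ∧ ∀ U : Set Y, IsOpen U → ∀ y ∈ U, ∃ P ∈ Pfam, y ∈ P ∧ P ⊆ U

/-- `Pfam` is hereditarily closure-preserving: whenever `S P ⊆ P` is chosen for each `P ∈ Pfam`,
the resulting family is closure-preserving. -/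
def IsHCP (Pfam : Set (Set Y)) : Prop :=
  ∀ S : Set Y → Set Y, (∀ P ∈ Pfam, S P ⊆ P) →
    ∀ Qfam ⊆ Pfam, closure (⋃ P ∈ Qfam, S P) = ⋃ P ∈ Qfam, closure (S P)

/-- `Pfam = ⋃_{y} Pfam y` is a weak base: each `Pfam y` consists of sets containing `y`, is directed
downward, every open neighborhood of `y` contains a member of `Pfam y`, and a set `G` is open
whenever each of its points has a member of its family inside `G`. -/
def IsWeakBase (Pfam : Y → Set (Set Y)) : Prop :=
  (∀ y, ∀ P ∈ Pfam y, y ∈ P) ∧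
  (∀ y, ∀ U ∈ Pfam y, ∀ V ∈ Pfam y, ∃ W ∈ Pfam y, W ⊆ U ∩ V) ∧
  (∀ y, ∀ U : Set Y, IsOpen U → y ∈ U → ∃ P ∈ Pfam y, P ⊆ U) ∧
  (∀ G : Set Y, (∀ y ∈ G, ∃ P ∈ Pfam y, P ⊆ G) → IsOpen G)

end Defs

/-- An ℵ-space: a space with a σ-locally finite k-network. -/
def IsAlephSpace (Y : Type*) [TopologicalSpace Y] : Prop :=
  ∃ Pfam : ℕ → Set (Set Y), (∀ n, LocallyFiniteFam (Pfam n)) ∧ IsKNetwork (⋃ n, Pfam n)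

/-- A space with a σ-hereditarily closure-preserving k-network. -/
def HasSigmaHCPKNetwork (Y : Type*) [TopologicalSpace Y] : Prop :=
  ∃ Pfam : ℕ → Set (Set Y), (∀ n, IsHCP (Pfam n)) ∧ IsKNetwork (⋃ n, Pfam n)

/-- k*-metrizable: a space with a σ-compact-finite k-network. -/
def KStarMetrizable (Y : Type*) [TopologicalSpace Y] : Prop :=
  ∃ Pfam : ℕ → Set (Set Y), (∀ n, CompactFiniteFam (Pfam n)) ∧ IsKNetwork (⋃ n, Pfam n)

/-- A γ-space: there is `g : ℕ × Y → τ_Y` with `y ∈ g n y` such that `{g n y}` is a local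
base at `y` and for all `n, y` there is `m` with `z ∈ g m y → g n z ⊆ g n y`. -/
def IsGammaSpace (Y : Type*) [TopologicalSpace Y] : Prop :=
  ∃ g : ℕ → Y → Set Y,
    (∀ n y, IsOpen (g n y)) ∧ (∀ n y, y ∈ g n y) ∧
    (∀ y : Y, ∀ U : Set Y, IsOpen U → y ∈ U → ∃ n, g n y ⊆ U) ∧
    (∀ n, ∀ y : Y, ∃ m, ∀ z ∈ g m y, g n z ⊆ g n y)

lemma gamma_mono {Y : Type*} [TopologicalSpace Y] (h : IsGammaSpace Y) :
    ∃ g : ℕ → Y → Set Y,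
    (∀ n y, IsOpen (g n y)) ∧ (∀ n y, y ∈ g n y) ∧
    (∀ y : Y, ∀ U : Set Y, IsOpen U → y ∈ U → ∃ n, g n y ⊆ U) ∧
    (∀ n, ∀ y : Y, ∃ m, ∀ z ∈ g m y, g n z ⊆ g n y) ∧
    (∀ y m n, m ≤ n → g n y ⊆ g m y) := by
  obtain ⟨g, ho, hm, hb, hg⟩ := h
  refine ⟨fun n y => ⋂ i ∈ Finset.range (n+1), g i y, ?_, ?_, ?_, ?_, ?_⟩
  · intro n y
    exact isOpen_biInter_finset fun i _ => ho i y
  · intro n y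
    simp only [mem_iInter]
    exact fun i _ => hm i y
  · intro y U hU hy
    obtain ⟨n, hn⟩ := hb y U hU hy
    refine ⟨n, fun z hz => hn ?_⟩
    simp only [mem_iInter] at hz
    exact hz n (by simp)
  · intro n y
    choose m hm' using fun i => hg i y
    refine ⟨(Finset.range (n+1)).sup m, fun z hz w hw => ?_⟩
    simp only [mem_iInter] at hz hw ⊢
    intro i hi
    refine hm' i z (hz (m i) ?_) (hw i hi)
    have := Finset.le_sup (f := m) hi
    simp only [Finset.mem_range]
    omega
  · intro y m n hmn z hz
    simp only [mem_iInter, Finset.mem_range] at hz ⊢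
    exact fun i hi => hz i (by omega)

/-- Vietoris neighbourhood of a set given by neighbourhoods of its points. -/
def gbox {X : Type*} [TopologicalSpace X] (V : X → Set X) (A : Set X) : Set (VHyper X) :=
  {B | (∀ b ∈ B.carrier, ∃ a ∈ A, b ∈ V a) ∧ ∀ a ∈ A, (B.carrier ∩ V a).Nonempty}

lemma gbox_isOpen {X : Type*} [TopologicalSpace X] (V : X → Set X) (hV : ∀ x, IsOpen (V x))
    (A : Set X) (hA : A.Finite) : IsOpen (gbox V A) := by
  classical
  refine TopologicalSpace.isOpen_generateFrom_of_mem ⟨hA.toFinset.image V, ?_, ?_⟩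
  · intro U hU
    simp only [Finset.mem_image] at hU
    obtain ⟨a, _, rfl⟩ := hU
    exact hV a
  · ext B
    simp [gbox, VHyper.vbox, Set.subset_def]

lemma gbox_base {X : Type*} [TopologicalSpace X] (g : ℕ → X → Set X)
    (hm : ∀ n y, y ∈ g n y)
    (hb : ∀ y : X, ∀ U : Set X, IsOpen U → y ∈ U → ∃ n, g n y ⊆ U)
    (hmono : ∀ y m n, m ≤ n → g n y ⊆ g m y)
    (A : VHyper X) (hA : A.carrier.Finite) (U : Set (VHyper X)) (hU : IsOpen U) (hAU : A ∈ U) :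
    ∃ n, gbox (g n) A.carrier ⊆ U := by
  have gm : ∀ m n, m ≤ n → gbox (g n) A.carrier ⊆ gbox (g m) A.carrier := by
    intro m n hmn B hB
    refine ⟨fun b hbB => ?_, fun a ha => ?_⟩
    · obtain ⟨a, ha, h⟩ := hB.1 b hbB
      exact ⟨a, ha, hmono a m n hmn h⟩
    · obtain ⟨b, h1, h2⟩ := hB.2 a ha
      exact ⟨b, h1, hmono a m n hmn h2⟩
  have hU' : TopologicalSpace.GenerateOpen _ U := hU
  induction hU' with
  | basic s hs =>
    obtain ⟨Ps, hPo, rfl⟩ := hs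
    have key : ∀ p : X × Set X, ∃ n, p.2 ∈ Ps → p.1 ∈ p.2 → g n p.1 ⊆ p.2 := by
      rintro ⟨x, P⟩
      by_cases h : P ∈ Ps ∧ x ∈ P
      · obtain ⟨n, hn⟩ := hb x P (hPo P h.1) h.2
        exact ⟨n, fun _ _ => hn⟩
      · exact ⟨0, fun h1 h2 => (h ⟨h1, h2⟩).elim⟩
    choose N hN using key
    have hsub : ∀ a ∈ A.carrier, ∀ P ∈ Ps, a ∈ P →
        g ((hA.toFinset ×ˢ Ps).sup N) a ⊆ P := by
      intro a ha P hP haP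
      refine (hmono a (N (a, P)) _ ?_).trans (hN (a, P) hP haP)
      exact Finset.le_sup (by simp [ha, hP])
    refine ⟨(hA.toFinset ×ˢ Ps).sup N, fun B hB => ⟨fun b hbB => ?_, fun P hP => ?_⟩⟩
    · obtain ⟨a, ha, h⟩ := hB.1 b hbB
      obtain ⟨P, hP, haP⟩ := hAU.1 ha
      exact ⟨P, hP, hsub a ha P hP haP h⟩
    · obtain ⟨a, ha, haP⟩ := hAU.2 P hP
      obtain ⟨b, h1, h2⟩ := hB.2 a ha
      exact ⟨b, h1, hsub a ha P hP haP h2⟩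
  | univ => exact ⟨0, subset_univ _⟩
  | inter s t hs ht ihs iht =>
    obtain ⟨n, hn⟩ := ihs hs hAU.1
    obtain ⟨m, hm⟩ := iht ht hAU.2
    exact ⟨max n m, subset_inter ((gm _ _ (le_max_left _ _)).trans hn)
      ((gm _ _ (le_max_right _ _)).trans hm)⟩
  | sUnion S hS ih =>
    obtain ⟨s, hs, hAs⟩ := hAU
    obtain ⟨n, hn⟩ := ih s hs (hS s hs) hAs
    exact ⟨n, hn.trans (subset_sUnion_of_mem hs)⟩

/-- The singleton as a point of the hyperspace of finite sets. -/
def vsing {X : Type*} [TopologicalSpace X] (x : X) : VFin X :=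
  ⟨⟨{x}, isCompact_singleton, singleton_nonempty x⟩, finite_singleton x⟩

lemma vsing_continuous {X : Type*} [TopologicalSpace X] : Continuous (vsing (X := X)) := by
  refine Continuous.subtype_mk (continuous_generateFrom_iff.2 ?_) _
  rintro s ⟨Ps, hPo, rfl⟩
  have : (fun x : X => (⟨{x}, isCompact_singleton, singleton_nonempty x⟩ : VHyper X)) ⁻¹'
      VHyper.vbox Ps = ⋃₀ (Ps : Set (Set X)) ∩ ⋂ P ∈ Ps, P := by
    ext x
    simp [VHyper.vbox]
  rw [this]
  exact (isOpen_sUnion fun P hP => hPo P hP).inter (isOpen_biInter_finset fun P hP => hPo P hP)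

/-- `X` is a γ-space iff `ℱ(X)` is a γ-space. -/
theorem statement18 {X : Type*} [TopologicalSpace X] [T2Space X] [RegularSpace X] :
    IsGammaSpace X ↔ IsGammaSpace (VFin X) := by
  constructor
  · intro h
    obtain ⟨g, ho, hm, hb, hg, hmono⟩ := gamma_mono h
    refine ⟨fun n A => Subtype.val ⁻¹' gbox (g n) A.1.carrier, ?_, ?_, ?_, ?_⟩
    · intro n A
      exact (gbox_isOpen (g n) (ho n) _ A.2).preimage continuous_subtype_val
    · intro n A
      exact ⟨fun a ha => ⟨a, ha, hm n a⟩, fun a ha => ⟨a, ha, hm n a⟩⟩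
    · intro A U hU hAU
      obtain ⟨W, hW, rfl⟩ := isOpen_induced_iff.1 hU
      obtain ⟨n, hn⟩ := gbox_base g hm hb hmono A.1 A.2 W hW hAU
      exact ⟨n, preimage_mono hn⟩
    · intro n A
      choose m hm' using hg n
      have hs : ∀ a ∈ A.1.carrier, ∀ z ∈ g (A.2.toFinset.sup m) a, g n z ⊆ g n a := by
        intro a ha z hz
        exact hm' a z (hmono a _ _ (Finset.le_sup (by simpa using ha)) hz)
      refine ⟨A.2.toFinset.sup m, fun B hB C hC => ⟨fun c hc => ?_, fun a ha => ?_⟩⟩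
      · obtain ⟨b, hbB, hcb⟩ := hC.1 c hc
        obtain ⟨a, ha, hba⟩ := hB.1 b hbB
        exact ⟨a, ha, hs a ha b hba hcb⟩
      · obtain ⟨b, hbB, hba⟩ := hB.2 a ha
        obtain ⟨c, hc, hcb⟩ := hC.2 b hbB
        exact ⟨c, hc, hs a ha b hba hcb⟩
  · rintro ⟨G, ho, hm, hb, hg⟩
    refine ⟨fun n x => vsing ⁻¹' G n (vsing x), ?_, ?_, ?_, ?_⟩
    · exact fun n x => (ho n _).preimage vsing_continuous
    · exact fun n x => hm n _
    · intro x U hU hx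
      have hop : IsOpen (Subtype.val ⁻¹' VHyper.vbox {U} : Set (VFin X)) :=
        IsOpen.preimage continuous_subtype_val
          (TopologicalSpace.isOpen_generateFrom_of_mem ⟨{U}, by simpa using hU, rfl⟩)
      obtain ⟨n, hn⟩ := hb (vsing x) _ hop (by
        change ({x} : Set X) ⊆ ⋃₀ (({U} : Finset (Set X)) : Set (Set X)) ∧
          ∀ P ∈ ({U} : Finset (Set X)), (({x} : Set X) ∩ P).Nonempty
        simp [hx])
      refine ⟨n, fun y hy => ?_⟩
      have h1 : ({y} : Set X) ⊆ ⋃₀ (({U} : Finset (Set X)) : Set (Set X)) := (hn hy).1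
      simpa using h1
    · intro n x
      obtain ⟨m, h⟩ := hg n (vsing x)
      exact ⟨m, fun z hz => preimage_mono (h _ hz)⟩
end

section
/- Let X be a regular T2 space in which every singleton is a G_δ-set (countable pseudocharacter). Then the following are equivalent: (1) X is semi-metrizable; (2) ℱ(X) is symmetrizable; (3) ℱ(X) is semi-metrizable. -/
open TopologicalSpace Set

/-- A symmetric on `Y`: a nonnegative symmetric function vanishing exactly on the
diagonal. -/
def IsSymmetricFn {Y : Type*} (d : Y → Y → ℝ) : Prop :=
  (∀ a b, 0 ≤ d a b) ∧ (∀ a b : Y, d a b = 0 ↔ a = b) ∧ (∀ a b, d a b = d b a)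

/-- A symmetrizable space: a set is open iff it contains a `d`-ball around each of
its points. -/
def Symmetrizable (Y : Type*) [TopologicalSpace Y] : Prop :=
  ∃ d : Y → Y → ℝ, IsSymmetricFn d ∧
    ∀ U : Set Y, IsOpen U ↔ ∀ y ∈ U, ∃ ε > 0, {z | d y z < ε} ⊆ U

/-- A semi-metrizable space: the `d`-balls around each point form a neighborhood base. -/
def SemiMetrizable (Y : Type*) [TopologicalSpace Y] : Prop :=
  ∃ d : Y → Y → ℝ, IsSymmetricFn d ∧
    ∀ (y : Y) (U : Set Y), U ∈ nhds y ↔ ∃ ε > 0, {z | d y z < ε} ⊆ U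

open Filter Topology

section Helpers

variable {X : Type*} [TopologicalSpace X]

def mkVFin (s : Set X) (hs : s.Finite) (hn : s.Nonempty) : VFin X :=
  ⟨⟨s, hs.isCompact, hn⟩, hs⟩

theorem VFin.ext_carrier {A B : VFin X} (h : A.1.carrier = B.1.carrier) : A = B := by
  obtain ⟨⟨a, _, _⟩, _⟩ := A
  obtain ⟨⟨b, _, _⟩, _⟩ := B
  simp only at h
  subst h
  rfl

theorem isOpen_vbox_fin (Ps : Finset (Set X)) (h : ∀ U ∈ Ps, IsOpen U) :
    IsOpen {A : VFin X | A.1 ∈ VHyper.vbox Ps} := by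
  have h1 : IsOpen (VHyper.vbox Ps) := TopologicalSpace.isOpen_generateFrom_of_mem ⟨Ps, h, rfl⟩
  exact h1.preimage (continuous_subtype_val (p := fun A : VHyper X => A.carrier.Finite))

theorem isOpen_sub {U : Set X} (hU : IsOpen U) : IsOpen {A : VFin X | A.1.carrier ⊆ U} := by
  convert isOpen_vbox_fin {U} (by simpa using hU) using 1
  ext A
  simp only [VHyper.vbox, mem_setOf_eq, Finset.coe_singleton, sUnion_singleton,
    Finset.mem_singleton, forall_eq]
  constructor
  · intro h
    refine ⟨h, ?_⟩
    obtain ⟨a, ha⟩ := A.1.nonempty'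
    exact ⟨a, ha, h ha⟩
  · exact fun h => h.1

theorem isOpen_meet {U : Set X} (hU : IsOpen U) :
    IsOpen {A : VFin X | (A.1.carrier ∩ U).Nonempty} := by
  classical
  convert isOpen_vbox_fin {univ, U} (by simpa using hU) using 1
  ext A
  simp [VHyper.vbox, A.1.nonempty']

theorem vfin_open_basis {S : Set (VFin X)} (hS : IsOpen S) {A : VFin X} (hA : A ∈ S)
    (B : ℝ → Set (VFin X)) (hB : ∀ r s, r ≤ s → B r ⊆ B s)
    (h : ∀ Ps : Finset (Set X), (∀ U ∈ Ps, IsOpen U) → A.1 ∈ VHyper.vbox Ps →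
      ∃ ε > 0, ∀ C ∈ B ε, C.1 ∈ VHyper.vbox Ps) : ∃ ε > 0, B ε ⊆ S := by
  obtain ⟨S', hS', rfl⟩ := hS
  have key : ∀ T : Set (VHyper X), TopologicalSpace.GenerateOpen
      {S : Set (VHyper X) | ∃ Ps : Finset (Set X), (∀ U ∈ Ps, IsOpen U) ∧ S = VHyper.vbox Ps} T →
      A.1 ∈ T → ∃ ε > 0, ∀ C ∈ B ε, C.1 ∈ T := by
    intro T hT
    induction hT with
    | basic s hs =>
      obtain ⟨Ps, h1, rfl⟩ := hs
      exact h Ps h1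
    | univ => exact fun _ => ⟨1, one_pos, fun _ _ => mem_univ _⟩
    | inter s t _ _ ih1 ih2 =>
      intro hm
      obtain ⟨e1, he1, h1⟩ := ih1 hm.1
      obtain ⟨e2, he2, h2⟩ := ih2 hm.2
      exact ⟨min e1 e2, lt_min he1 he2, fun C hC =>
        ⟨h1 C (hB _ _ (min_le_left _ _) hC), h2 C (hB _ _ (min_le_right _ _) hC)⟩⟩
    | sUnion K _ ih =>
      rintro ⟨s, hs, hm⟩
      obtain ⟨e, he, h1⟩ := ih s hs hm
      exact ⟨e, he, fun C hC => ⟨s, hs, h1 C hC⟩⟩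
  obtain ⟨ε, hε, h2⟩ := key S' hS' hA
  exact ⟨ε, hε, h2⟩

/-- Hausdorff type relation. -/
def hrel (d : X → X → ℝ) (A B : Set X) (r : ℝ) : Prop :=
  0 ≤ r ∧ (∀ a ∈ A, ∃ b ∈ B, d a b ≤ r) ∧ (∀ b ∈ B, ∃ a ∈ A, d a b ≤ r)

noncomputable def hdist (d : X → X → ℝ) (A B : VFin X) : ℝ :=
  sInf {r | hrel d A.1.carrier B.1.carrier r}

theorem hrel_nonempty (d : X → X → ℝ) (A B : VFin X) :
    {r | hrel d A.1.carrier B.1.carrier r}.Nonempty := by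
  have hf : ((fun p : X × X => d p.1 p.2) '' (A.1.carrier ×ˢ B.1.carrier)).Finite :=
    (A.2.prod B.2).image _
  obtain ⟨R, hR⟩ := hf.bddAbove
  have hR' : ∀ a ∈ A.1.carrier, ∀ b ∈ B.1.carrier, d a b ≤ R := fun a ha b hb =>
    hR ⟨(a, b), ⟨ha, hb⟩, rfl⟩
  obtain ⟨a0, ha0⟩ := A.1.nonempty'
  obtain ⟨b0, hb0⟩ := B.1.nonempty'
  exact ⟨max R 0, le_max_right _ _,
    fun a ha => ⟨b0, hb0, (hR' a ha b0 hb0).trans (le_max_left _ _)⟩,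
    fun b hb => ⟨a0, ha0, (hR' a0 ha0 b hb).trans (le_max_left _ _)⟩⟩

theorem hdist_lt (d : X → X → ℝ) (A B : VFin X) (ε : ℝ) :
    hdist d A B < ε ↔ ∃ r, hrel d A.1.carrier B.1.carrier r ∧ r < ε :=
  csInf_lt_iff ⟨0, fun _ h => h.1⟩ (hrel_nonempty d A B)

theorem hdist_nonneg (d : X → X → ℝ) (A B : VFin X) : 0 ≤ hdist d A B :=
  Real.sInf_nonneg fun _ h => h.1

theorem finite_zero {d : X → X → ℝ} (hd : IsSymmetricFn d) {B : Set X} (hB : B.Finite) (a : X)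
    (h : ∀ ε > 0, ∃ b ∈ B, d a b < ε) : a ∈ B := by
  by_contra ha
  have : ∀ᶠ ε in 𝓝[>] (0:ℝ), ∀ b ∈ B, ε < d a b := by
    rw [eventually_all_finite hB]
    intro b hb
    have : 0 < d a b := lt_of_le_of_ne (hd.1 a b)
      (fun h0 => ha (by rwa [(hd.2.1 a b).1 h0.symm]))
    exact mem_nhdsWithin_of_mem_nhds (Iio_mem_nhds this)
  obtain ⟨ε, h1, h2⟩ := (this.and self_mem_nhdsWithin).exists
  obtain ⟨b, hb, h3⟩ := h ε h2
  exact absurd (h1 b hb) (not_lt.2 h3.le)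

theorem hdist_symmetric {d : X → X → ℝ} (hd : IsSymmetricFn d) :
    IsSymmetricFn (hdist d : VFin X → VFin X → ℝ) := by
  refine ⟨hdist_nonneg d, ?_, ?_⟩
  · intro A B
    constructor
    · intro h0
      have h : ∀ ε > 0, ∃ r, hrel d A.1.carrier B.1.carrier r ∧ r < ε := fun ε hε =>
        (hdist_lt d A B ε).1 (by rw [h0]; exact hε)
      apply VFin.ext_carrier
      apply Subset.antisymm
      · intro a ha
        apply finite_zero hd B.2
        intro ε hε
        obtain ⟨r, hr, hlt⟩ := h ε hε
        obtain ⟨b, hb, h1⟩ := hr.2.1 a ha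
        exact ⟨b, hb, h1.trans_lt hlt⟩
      · intro b hb
        apply finite_zero hd A.2
        intro ε hε
        obtain ⟨r, hr, hlt⟩ := h ε hε
        obtain ⟨a, ha, h1⟩ := hr.2.2 b hb
        exact ⟨a, ha, by rw [hd.2.2]; exact h1.trans_lt hlt⟩
    · rintro rfl
      apply le_antisymm _ (hdist_nonneg d A A)
      have h0 : ∀ a, d a a ≤ 0 := fun a => ((hd.2.1 a a).2 rfl).le
      exact csInf_le ⟨0, fun _ h => h.1⟩
        ⟨le_rfl, fun a ha => ⟨a, ha, h0 a⟩, fun a ha => ⟨a, ha, h0 a⟩⟩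
  · intro A B
    unfold hdist
    congr 1
    ext r
    simp only [hrel, mem_setOf_eq]
    constructor
    · rintro ⟨h0, h1, h2⟩
      exact ⟨h0, fun a ha => by simpa only [hd.2.2] using h2 a ha,
        fun a ha => by simpa only [hd.2.2] using h1 a ha⟩
    · rintro ⟨h0, h1, h2⟩
      exact ⟨h0, fun a ha => by simpa only [hd.2.2] using h2 a ha,
        fun a ha => by simpa only [hd.2.2] using h1 a ha⟩

theorem semi_vfin (h : SemiMetrizable X) : SemiMetrizable (VFin X) := by
  obtain ⟨d, hd, hn⟩ := h
  refine ⟨hdist d, hdist_symmetric hd, ?_⟩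
  intro A S
  constructor
  · intro hS
    obtain ⟨T, hTS, hT, hAT⟩ := mem_nhds_iff.1 hS
    obtain ⟨ε, hε, h1⟩ := vfin_open_basis hT hAT (fun ε => {C | hdist d A C < ε})
      (fun r s hrs C hC => lt_of_lt_of_le hC hrs) (by
        intro Ps hPs hA
        have : ∀ a, ∀ᶠ ε in 𝓝[>] (0:ℝ), ∀ U ∈ Ps, a ∈ U → {z | d a z < ε} ⊆ U := by
          intro a
          have := (eventually_all_finite (l := 𝓝[>] (0:ℝ)) Ps.finite_toSet
            (p := fun U ε => a ∈ U → {z | d a z < ε} ⊆ U)).2 (by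
            intro U hU
            by_cases ha : a ∈ U
            · obtain ⟨e, he, h2⟩ := (hn a U).1 ((hPs U hU).mem_nhds ha)
              filter_upwards [mem_nhdsWithin_of_mem_nhds (Iio_mem_nhds he)] with x hx _
              exact fun z hz => h2 (show d a z < e from lt_trans (show d a z < x from hz) hx)
            · exact Eventually.of_forall fun _ h => absurd h ha)
          exact this
        have h2 := (eventually_all_finite (l := 𝓝[>] (0:ℝ)) A.2
            (p := fun a ε => ∀ U ∈ Ps, a ∈ U → {z | d a z < ε} ⊆ U)).2 (fun a _ => this a)
        obtain ⟨ε, h3, hε⟩ := (h2.and self_mem_nhdsWithin).exists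
        refine ⟨ε, hε, ?_⟩
        intro C hC
        obtain ⟨r, hr, hrε⟩ := (hdist_lt d A C ε).1 hC
        constructor
        · intro c hc
          obtain ⟨a, ha, hac⟩ := hr.2.2 c hc
          obtain ⟨U, hU, haU⟩ := hA.1 ha
          exact ⟨U, hU, h3 a ha U hU haU (hac.trans_lt hrε)⟩
        · intro U hU
          obtain ⟨a, ha, haU⟩ := hA.2 U hU
          obtain ⟨c, hc, hac⟩ := hr.2.1 a ha
          exact ⟨c, hc, h3 a ha U hU haU (hac.trans_lt hrε)⟩)
    exact ⟨ε, hε, h1.trans hTS⟩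
  · rintro ⟨ε, hε, hS⟩
    apply mem_of_superset _ hS
    have hb : ∀ a, {z | d a z < ε / 2} ∈ 𝓝 a := fun a => (hn a _).2 ⟨ε / 2, half_pos hε, Subset.rfl⟩
    have h1 : {C : VFin X | C.1.carrier ⊆ interior (⋃ a ∈ A.1.carrier, {z | d a z < ε / 2})}
        ∈ 𝓝 A := by
      apply (isOpen_sub isOpen_interior).mem_nhds
      intro a ha
      rw [mem_interior_iff_mem_nhds]
      exact mem_of_superset (hb a) (subset_biUnion_of_mem (u := fun a => {z | d a z < ε / 2}) ha)
    have h2 : ∀ᶠ C : VFin X in 𝓝 A, ∀ a ∈ A.1.carrier,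
        (C.1.carrier ∩ interior {z | d a z < ε / 2}).Nonempty := by
      rw [eventually_all_finite A.2]
      intro a ha
      exact (isOpen_meet isOpen_interior).mem_nhds ⟨a, ha, mem_interior_iff_mem_nhds.2 (hb a)⟩
    filter_upwards [h1, h2] with C hC1 hC2
    refine (hdist_lt d A C ε).2 ⟨ε / 2, ⟨(half_pos hε).le, ?_, ?_⟩, half_lt_self hε⟩
    · intro a ha
      obtain ⟨c, hc, h3⟩ := hC2 a ha
      exact ⟨c, hc, le_of_lt (show c ∈ {z | d a z < ε / 2} from interior_subset h3)⟩
    · intro c hc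
      obtain ⟨a, ha, h3⟩ := mem_iUnion₂.1 (interior_subset (hC1 hc))
      exact ⟨a, ha, (show d a c < ε / 2 from h3).le⟩

theorem SemiMetrizable.symm' (h : SemiMetrizable X) : Symmetrizable X := by
  obtain ⟨d, hd, hn⟩ := h
  refine ⟨d, hd, fun U => ?_⟩
  rw [isOpen_iff_mem_nhds]
  exact forall₂_congr fun y _ => hn y U

theorem Symmetrizable.sequential (h : Symmetrizable X) : SequentialSpace X := by
  obtain ⟨d, hd, hn⟩ := h
  refine ⟨fun C hC => ?_⟩
  rw [← isOpen_compl_iff, hn]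
  intro y hy
  by_contra hcon
  push Not at hcon
  have : ∀ n : ℕ, ∃ c ∈ C, d y c < 1 / ((n : ℝ) + 1) := by
    intro n
    obtain ⟨c, hc, h1⟩ := not_subset.1 (hcon (1 / ((n : ℝ) + 1)) Nat.one_div_pos_of_nat)
    exact ⟨c, not_not.1 h1, hc⟩
  choose c hc hlt using this
  apply hy
  apply hC hc
  rw [tendsto_nhds]
  intro U hU hyU
  obtain ⟨ε, hε, h2⟩ := (hn U).1 hU y hyU
  have := (tendsto_one_div_add_atTop_nhds_zero_nat (𝕜 := ℝ)).eventually (Iio_mem_nhds hε)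
  filter_upwards [this] with n hn'
  exact h2 ((hlt n).trans hn')

theorem symm_of_frechet [T2Space X] (h : Symmetrizable X) [FrechetUrysohnSpace X] :
    SemiMetrizable X := by
  obtain ⟨d, hd, hn⟩ := h
  refine ⟨d, hd, fun y U => ⟨?_, ?_⟩⟩
  · intro hU
    obtain ⟨V, hVU, hV, hy⟩ := mem_nhds_iff.1 hU
    obtain ⟨ε, hε, h1⟩ := (hn V).1 hV y hy
    exact ⟨ε, hε, h1.trans hVU⟩
  · rintro ⟨ε, hε, hU⟩
    by_contra hcon
    have hy : y ∈ closure Uᶜ := by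
      rw [closure_compl, mem_compl_iff, mem_interior_iff_mem_nhds]
      exact hcon
    rw [mem_closure_iff_seq_limit] at hy
    obtain ⟨u, huU, hu⟩ := hy
    have hcl : IsClosed (insert y (range u)) := hu.isCompact_insert_range.isClosed
    have hop : IsOpen (range u)ᶜ := by
      rw [hn]
      intro w hw
      by_cases hwy : w = y
      · subst hwy
        refine ⟨ε, hε, ?_⟩
        rintro z hz ⟨n, rfl⟩
        exact huU n (hU hz)
      · obtain ⟨e, he, h1⟩ := (hn _).1 hcl.isOpen_compl w (by
          rintro (h | h)
          · exact hwy h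
          · exact hw h)
        exact ⟨e, he, fun z hz hz' => h1 hz (Or.inr hz')⟩
    have hyy : y ∈ (range u)ᶜ := by
      rintro ⟨n, hn'⟩
      apply huU n
      apply hU
      simp only [mem_setOf_eq, hn']
      rw [(hd.2.1 y y).2 rfl]
      exact hε
    obtain ⟨n, hn'⟩ := (hu.eventually (hop.mem_nhds hyy)).exists
    exact hn' ⟨n, rfl⟩

def sing (x : X) : VFin X := mkVFin {x} (finite_singleton x) (singleton_nonempty x)

theorem sing_sub {x : X} {U : Set X} : (sing x).1.carrier ⊆ U ↔ x ∈ U := by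
  simp [sing, mkVFin]

theorem symm_down [T2Space X] (h : Symmetrizable (VFin X)) : Symmetrizable X := by
  obtain ⟨D, hD, hn⟩ := h
  have hinj : ∀ x y : X, sing x = sing y ↔ x = y := by
    intro x y
    constructor
    · intro h
      have : (sing x).1.carrier ⊆ {y} := by rw [h]; exact Subset.rfl
      exact (sing_sub (U := {y})).1 this
    · rintro rfl; rfl
  refine ⟨fun x y => D (sing x) (sing y), ⟨fun _ _ => hD.1 _ _, fun a b => ?_,
    fun _ _ => hD.2.2 _ _⟩, fun U => ⟨?_, ?_⟩⟩
  · simp only [hD.2.1, hinj]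
  · intro hU y hy
    obtain ⟨ε, hε, h1⟩ := (hn _).1 (isOpen_sub hU) (sing y) (sing_sub.2 hy)
    exact ⟨ε, hε, fun z hz => sing_sub.1 (h1 hz)⟩
  · intro hU
    have hop : IsOpen (sing '' Uᶜ)ᶜ := by
      rw [hn]
      intro F hF
      obtain ⟨a, ha⟩ := F.1.nonempty'
      by_cases hs : F.1.carrier ⊆ {a}
      · have hFa : F = sing a := VFin.ext_carrier (Subset.antisymm hs (by
          rintro b (rfl : b = a); exact ha))
        subst hFa
        have haU : a ∈ U := by
          by_contra h
          exact hF ⟨a, h, rfl⟩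
        obtain ⟨ε, hε, h1⟩ := hU a haU
        refine ⟨ε, hε, ?_⟩
        rintro _ hz ⟨z, hzU, rfl⟩
        exact hzU (h1 hz)
      · obtain ⟨b, hb, hba⟩ := not_subset.1 hs
        obtain ⟨V, W, hV, hW, hbV, haW, hVW⟩ := t2_separation (show b ≠ a from hba)
        obtain ⟨ε, hε, h1⟩ := (hn _).1 ((isOpen_meet hV).inter (isOpen_meet hW)) F
          ⟨⟨b, hb, hbV⟩, ⟨a, ha, haW⟩⟩
        refine ⟨ε, hε, ?_⟩
        rintro _ hz ⟨z, hzU, rfl⟩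
        obtain ⟨⟨p, hp, hpV⟩, ⟨q, hq, hqW⟩⟩ := h1 hz
        obtain rfl : p = z := hp
        obtain rfl : q = p := hq
        exact disjoint_left.1 hVW hpV hqW
    have hc : Continuous (sing : X → VFin X) := by
      apply Continuous.subtype_mk
      rw [continuous_generateFrom_iff]
      rintro _ ⟨Ps, hPs, rfl⟩
      have : (fun x : X => (sing x).1) ⁻¹' VHyper.vbox Ps
          = ⋃₀ (Ps : Set (Set X)) ∩ ⋂ P ∈ (Ps : Set (Set X)), P := by
        ext x
        simp only [mem_preimage, VHyper.vbox, mem_setOf_eq, sing_sub, mem_inter_iff, mem_iInter]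
        simp [sing, mkVFin]
      exact this ▸ (isOpen_sUnion hPs).inter (Ps.finite_toSet.isOpen_biInter hPs)
    convert hop.preimage hc using 1
    ext x
    simp only [mem_preimage, mem_compl_iff, mem_image, hinj]
    simp

theorem isClosed_mem [T1Space X] (x : X) : IsClosed {F : VFin X | x ∈ F.1.carrier} := by
  rw [← isOpen_compl_iff]
  convert isOpen_sub (isOpen_compl_singleton (x := x)) using 1
  ext F
  simp

theorem vfin_t1 [T1Space X] : T1Space (VFin X) := by
  refine ⟨fun E => ?_⟩
  have h1 : IsClosed {F : VFin X | F.1.carrier ⊆ E.1.carrier} := by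
    rw [← isOpen_compl_iff]
    convert isOpen_meet E.2.isClosed.isOpen_compl using 1
    ext F
    simp [not_subset, Set.Nonempty]
  have h2 : IsClosed (⋂ x ∈ E.1.carrier, {F : VFin X | x ∈ F.1.carrier}) :=
    isClosed_biInter fun x _ => isClosed_mem x
  convert h1.inter h2 using 1
  ext F
  simp only [mem_singleton_iff, mem_inter_iff, mem_setOf_eq, mem_iInter]
  constructor
  · rintro rfl; exact ⟨Subset.rfl, fun _ h => h⟩
  · exact fun h => VFin.ext_carrier (Subset.antisymm h.1 h.2)

theorem closed_nhds_seq [RegularSpace X] (x : X)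
    (hpsi : ∃ U : ℕ → Set X, (∀ n, IsOpen (U n)) ∧ ⋂ n, U n = {x}) :
    ∃ T : ℕ → Set X, Antitone T ∧ (∀ n, T n ∈ 𝓝 x) ∧ (∀ n, IsClosed (T n)) ∧
      ∀ y, (∀ n, y ∈ T n) → y = x := by
  obtain ⟨U, hU, hx⟩ := hpsi
  have hxU : ∀ n, U n ∈ 𝓝 x := fun n => (hU n).mem_nhds (by
    have : x ∈ ⋂ n, U n := by rw [hx]; rfl
    exact mem_iInter.1 this n)
  choose V hV hVc hVU using fun n => exists_mem_nhds_isClosed_subset (hxU n)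
  refine ⟨fun n => ⋂ k ∈ Iic n, V k, ?_, ?_, ?_, ?_⟩
  · intro m n hmn
    exact biInter_subset_biInter_left (Iic_subset_Iic.2 hmn)
  · intro n
    exact (biInter_mem (finite_Iic n)).2 fun k _ => hV k
  · intro n
    exact isClosed_biInter fun k _ => hVc k
  · intro y hy
    have : y ∈ ⋂ n, U n := mem_iInter.2 fun n => hVU n (mem_iInter₂.1 (hy n) n (mem_Iic.2 le_rfl))
    rw [hx] at this
    exact this

theorem core [T2Space X] [SequentialSpace (VFin X)] (x : X) (A : Set X)
    (T : ℕ → Set X) (hTa : Antitone T) (hTc : ∀ n, IsClosed (T n))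
    (hTx : ∀ y, (∀ n, y ∈ T n) → y = x)
    (u : ℕ → X) (hux : Tendsto u atTop (𝓝 x)) (hne : ∀ n, u n ≠ x) (huT : ∀ n, u n ∈ T n)
    (z : ℕ → ℕ → X) (hzA : ∀ n m, z n m ∈ A) (hz : ∀ n, Tendsto (z n) atTop (𝓝 (u n)))
    (hzT : ∀ n m, z n m ∈ T n) : x ∈ seqClosure A := by
  haveI : T1Space (VFin X) := vfin_t1
  let F : ℕ → ℕ → VFin X := fun n p => mkVFin (insert (z n p) (u '' Icc n p))
    (((finite_Icc n p).image u).insert _) (insert_nonempty _ _)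
  have hF : ∀ n p, (F n p).1.carrier = insert (z n p) (u '' Icc n p) := fun _ _ => rfl
  let C : Set (VFin X) := {G | ∃ n p, n ≤ p ∧ G = F n p}
  have hnot : sing x ∉ C := by
    rintro ⟨n, p, hnp, h⟩
    have h1 : u n ∈ (F n p).1.carrier := Or.inr ⟨n, ⟨le_rfl, hnp⟩, rfl⟩
    rw [← h] at h1
    exact hne n h1
  have hcl : sing x ∈ closure C := by
    rw [mem_closure_iff_nhds]
    intro S hS
    obtain ⟨S', hS'S, hS', hxS⟩ := mem_nhds_iff.1 hS
    -- the set of `y` around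
    have key : ∃ U : Set X, IsOpen U ∧ x ∈ U ∧ ∀ G : VFin X, G.1.carrier ⊆ U → G ∈ S' := by
      obtain ⟨S'', hS'', rfl⟩ := hS'
      have : ∀ T : Set (VHyper X), TopologicalSpace.GenerateOpen
        {S : Set (VHyper X) | ∃ Ps : Finset (Set X), (∀ U ∈ Ps, IsOpen U) ∧
          S = VHyper.vbox Ps} T →
        (sing x).1 ∈ T → ∃ U : Set X, IsOpen U ∧ x ∈ U ∧
          ∀ G : VFin X, G.1.carrier ⊆ U → G.1 ∈ T := by
        intro T hT
        induction hT with
        | basic s hs =>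
          obtain ⟨Ps, h1, rfl⟩ := hs
          rintro ⟨h2, h3⟩
          have h4 : ∀ P ∈ (Ps : Set (Set X)), x ∈ P := by
            intro P hP
            obtain ⟨y, hy, hyP⟩ := h3 P hP
            obtain rfl : y = x := hy
            exact hyP
          refine ⟨⋂ P ∈ (Ps : Set (Set X)), P, Ps.finite_toSet.isOpen_biInter h1,
            mem_iInter₂.2 h4, ?_⟩
          intro G hG
          refine ⟨?_, ?_⟩
          · obtain ⟨P, hP, _⟩ := sing_sub.1 h2
            exact fun g hg => ⟨P, hP, mem_iInter₂.1 (hG hg) P hP⟩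
          · intro P hP
            obtain ⟨g, hg⟩ := G.1.nonempty'
            exact ⟨g, hg, mem_iInter₂.1 (hG hg) P hP⟩
        | univ => exact fun _ => ⟨univ, isOpen_univ, mem_univ _, fun _ _ => mem_univ _⟩
        | inter s t _ _ ih1 ih2 =>
          intro hm
          obtain ⟨U, h1, h2, h3⟩ := ih1 hm.1
          obtain ⟨V, h4, h5, h6⟩ := ih2 hm.2
          exact ⟨U ∩ V, h1.inter h4, ⟨h2, h5⟩, fun G hG =>
            ⟨h3 G (hG.trans inter_subset_left), h6 G (hG.trans inter_subset_right)⟩⟩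
        | sUnion K _ ih =>
          rintro ⟨s, hs, hm⟩
          obtain ⟨U, h1, h2, h3⟩ := ih s hs hm
          exact ⟨U, h1, h2, fun G hG => ⟨s, hs, h3 G hG⟩⟩
      exact this S'' hS'' hxS
    obtain ⟨U, hU, hxU, hUS⟩ := key
    obtain ⟨N, hN⟩ := eventually_atTop.1 (hux.eventually (hU.mem_nhds hxU))
    obtain ⟨p, hp1, hp2⟩ := (((hz N).eventually (hU.mem_nhds (hN N le_rfl))).and
      (eventually_ge_atTop N)).exists
    refine ⟨F N p, hS'S (hUS _ ?_), N, p, hp2, rfl⟩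
    rw [hF]
    rintro _ (rfl | ⟨i, hi, rfl⟩)
    · exact hp1
    · exact hN i hi.1
  have hnc : ¬ IsSeqClosed C := fun h => hnot (by
    have h1 := h.isClosed
    rwa [h1.closure_eq] at hcl)
  simp only [IsSeqClosed] at hnc
  push Not at hnc
  obtain ⟨s, E, hsC, hsE, hEC⟩ := hnc
  choose n p hnp hs using hsC
  by_cases hcase : ∀ N, ∃ᶠ j in atTop, N ≤ n j
  · obtain ⟨φ, hφ, hφn⟩ := extraction_forall_of_frequently hcase
    have ht : Tendsto (s ∘ φ) atTop (𝓝 E) := hsE.comp hφ.tendsto_atTop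
    have hEx : E.1.carrier ⊆ {x} := by
      intro y hy
      by_contra hyx
      have : ∃ N, y ∉ T N := by
        by_contra hcon
        push Not at hcon
        exact hyx (hTx y hcon)
      obtain ⟨N, hN⟩ := this
      have h1 := ht.eventually ((isOpen_meet (hTc N).isOpen_compl).mem_nhds ⟨y, hy, hN⟩)
      obtain ⟨k, ⟨w, hw, hwN⟩, hk2⟩ := (h1.and (eventually_ge_atTop N)).exists
      simp only [Function.comp, hs, hF] at hw
      have hNn : N ≤ n (φ k) := hk2.trans (hφn k)
      apply hwN
      rcases hw with rfl | ⟨i, hi, rfl⟩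
      · exact hTa hNn (hzT _ _)
      · exact hTa (hNn.trans hi.1) (huT _)
    refine ⟨fun k => z (n (φ k)) (p (φ k)), fun k => hzA _ _, ?_⟩
    rw [tendsto_nhds]
    intro U hU hxU
    have h1 := ht.eventually ((isOpen_sub hU).mem_nhds
      (hEx.trans (singleton_subset_iff.2 hxU)))
    filter_upwards [h1] with k hk
    apply hk
    simp only [Function.comp, hs, hF]
    exact Or.inl rfl
  · exfalso
    push Not at hcase
    obtain ⟨N, hN⟩ := hcase
    by_cases hp : ∀ P, ∃ᶠ j in atTop, P ≤ p j
    · have hmem : ∀ i, N ≤ i → u i ∈ E.1.carrier := by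
        intro i hi
        have h1 : ∃ᶠ j in atTop, s j ∈ {G : VFin X | u i ∈ G.1.carrier} := by
          refine ((hp i).and_eventually hN).mono ?_
          rintro j ⟨h1, h2⟩
          rw [mem_setOf_eq, hs, hF]
          exact Or.inr ⟨i, ⟨(not_le.1 (by simpa using h2)).le.trans hi, h1⟩, rfl⟩
        exact (isClosed_mem (u i)).mem_of_frequently_of_tendsto h1 hsE
      have hcl2 : IsClosed (E.1.carrier \ {x}) := (E.2.subset diff_subset).isClosed
      have := hcl2.mem_of_tendsto hux (by
        filter_upwards [eventually_ge_atTop N] with i hi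
        exact ⟨hmem i hi, hne i⟩)
      exact this.2 rfl
    · push Not at hp
      obtain ⟨P, hP⟩ := hp
      have hfin : ((fun q : ℕ × ℕ => F q.1 q.2) '' ((Iio N ×ˢ Iio P) ∩ {q | q.1 ≤ q.2})).Finite :=
        (((finite_Iio N).prod (finite_Iio P)).subset inter_subset_left).image _
      have := hfin.isClosed.mem_of_tendsto hsE (by
        filter_upwards [hN, hP] with j h1 h2
        exact ⟨(n j, p j), ⟨⟨by simpa using h1, by simpa using h2⟩, hnp j⟩, (hs j).symm⟩)
      obtain ⟨⟨a, b⟩, ⟨_, hab⟩, h3⟩ := this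
      exact hEC ⟨a, b, hab, h3.symm⟩

theorem frechet_of [T2Space X] [RegularSpace X] [SequentialSpace X] [SequentialSpace (VFin X)]
    (hpsi : ∀ x : X, ∃ U : ℕ → Set X, (∀ n, IsOpen (U n)) ∧ ⋂ n, U n = {x}) :
    FrechetUrysohnSpace X := by
  have key : ∀ A : Set X, seqClosure (seqClosure A) ⊆ seqClosure A := by
    rintro A x ⟨v, hvA, hv⟩
    by_contra hx
    obtain ⟨T, hTa, hTn, hTc, hTx⟩ := closed_nhds_seq x (hpsi x)
    have : ∀ n, ∃ k, n ≤ k ∧ v k ∈ interior (T n) := fun n =>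
      ((eventually_ge_atTop n).and
        (hv.eventually (interior_mem_nhds.2 (hTn n)))).exists
    choose φ hφ hφT using this
    have hφt : Tendsto φ atTop atTop := tendsto_atTop_mono hφ tendsto_id
    choose w hwA hw using hvA
    have : ∀ n, ∃ M, ∀ m ≥ M, w (φ n) m ∈ T n := fun n =>
      eventually_atTop.1 ((hw (φ n)).eventually (mem_interior_iff_mem_nhds.1 (hφT n)))
    choose M hM using this
    apply hx
    refine core x A T hTa hTc hTx (fun n => v (φ n)) (hv.comp hφt) ?_
      (fun n => interior_subset (hφT n)) (fun n m => w (φ n) (m + M n)) (fun n m => hwA _ _)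
      (fun n => (hw (φ n)).comp (tendsto_add_atTop_nat (M n)))
      (fun n m => hM n _ (Nat.le_add_left _ _))
    intro n h
    apply hx
    rw [← h]
    exact ⟨w (φ n), hwA _, hw _⟩
  refine ⟨fun A => ?_⟩
  have h1 : IsSeqClosed (seqClosure A) :=
    isSeqClosed_iff.2 (Subset.antisymm (key A) subset_seqClosure)
  exact closure_minimal subset_seqClosure h1.isClosed

end Helpers

/-- For `X` with countable pseudocharacter, TFAE: `X` is semi-metrizable; `ℱ(X)` is
symmetrizable; `ℱ(X)` is semi-metrizable. -/
theorem statement19 {X : Type*} [TopologicalSpace X] [T2Space X] [RegularSpace X]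
    (hpsi : ∀ x : X, ∃ U : ℕ → Set X, (∀ n, IsOpen (U n)) ∧ ⋂ n, U n = {x}) :
    List.TFAE [SemiMetrizable X, Symmetrizable (VFin X), SemiMetrizable (VFin X)] := by
  tfae_have 1 → 3 := semi_vfin
  tfae_have 3 → 2 := SemiMetrizable.symm'
  tfae_have 2 → 1 := by
    intro h
    have hX := symm_down h
    haveI := h.sequential
    haveI := hX.sequential
    haveI := frechet_of hpsi
    exact symm_of_frechet hX
  tfae_finish
end
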